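/- arXiv:2410.22853 — 4 statements merged into one kernel-verified Lean document; each statement's English description precedes it below -/
import Mathlib

section
/- For every integer n ≥ 0 and every x ∈ ℂ, the spherical Bessel function j_n satisfies the spherical Bessel differential equation: x²·j_n''(x) + 2x·j_n'(x) + (x² − n(n+1))·j_n(x) = 0, where j_n' and j_n'' denote the first and second complex derivatives of j_n. -/
open Complex

/-- The spherical Bessel function of the first kind `j_n`, defined by its power series
`j_n(x) = ∑_{m} (-1)^m x^(n+2m) / (2^m m! (2n+2m+1)!!)`. -/
noncomputable def sphBesselJ (n : ℕ) (x : ℂ) : ℂ :=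
  ∑' m : ℕ, ((-1 : ℂ) ^ m * x ^ (n + 2 * m)) /
    ((2 : ℂ) ^ m * (Nat.factorial m : ℂ) * (Nat.doubleFactorial (2 * (n + m) + 1) : ℂ))

/-- The spherical Neumann function `y_n`, defined by the series
`y_n(x) = -((2n)!/(2^n n!)) ∑_m (-1)^m x^(2m-n-1) / (2^m m! (-2n+1)(-2n+3)⋯(-2n+2m-1))`. -/
noncomputable def sphBesselY (n : ℕ) (x : ℂ) : ℂ :=
  -((Nat.factorial (2 * n) : ℂ) / ((2 : ℂ) ^ n * (Nat.factorial n : ℂ))) *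
    ∑' m : ℕ, ((-1 : ℂ) ^ m * x ^ (2 * (m : ℤ) - (n : ℤ) - 1)) /
      ((2 : ℂ) ^ m * (Nat.factorial m : ℂ) *
        ∏ j ∈ Finset.range m, ((2 * (j : ℂ) + 1) - 2 * (n : ℂ)))

/-- The spherical Hankel function of the first kind `h_n^{(1)} = j_n + i y_n`. -/
noncomputable def sphHankelH1 (n : ℕ) (x : ℂ) : ℂ :=
  sphBesselJ n x + Complex.I * sphBesselY n x

/-- A series of monomials that converges absolutely on all of `ℂ` keeps this property
under termwise differentiation. -/
theorem summable_norm_mul_pow_deriv {c : ℕ → ℂ} {e : ℕ → ℕ}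
    (h : ∀ R : ℝ, 0 ≤ R → Summable fun m => ‖c m‖ * R ^ e m) (R : ℝ) (hR : 0 ≤ R) :
    Summable fun m => ‖c m * (e m : ℂ)‖ * R ^ (e m - 1) := by
  refine Summable.of_nonneg_of_le (fun m => by positivity) (fun m => ?_)
    (h (2 * (1 + R)) (by positivity))
  rw [norm_mul, Complex.norm_natCast, mul_assoc, mul_pow]
  have h₁ : (e m : ℝ) ≤ 2 ^ e m := by exact_mod_cast Nat.lt_two_pow_self.le
  have h₂ : R ^ (e m - 1) ≤ (1 + R) ^ e m :=
    (pow_le_pow_left₀ hR (by linarith) _).trans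
      (pow_le_pow_right₀ (by linarith) (Nat.sub_le _ _))
  gcongr

theorem hasSum_mul_pow_of_summable_norm {c : ℕ → ℂ} {e : ℕ → ℕ}
    (h : ∀ R : ℝ, 0 ≤ R → Summable fun m => ‖c m‖ * R ^ e m) (x : ℂ) :
    HasSum (fun m => c m * x ^ e m) (∑' m, c m * x ^ e m) := by
  refine (Summable.of_norm ?_).hasSum
  simpa only [norm_mul, norm_pow] using h ‖x‖ (norm_nonneg x)

/-- Termwise differentiation of an everywhere absolutely convergent series of monomials. -/
theorem deriv_tsum_mul_pow {c : ℕ → ℂ} {e : ℕ → ℕ}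
    (h : ∀ R : ℝ, 0 ≤ R → Summable fun m => ‖c m‖ * R ^ e m) :
    deriv (fun x : ℂ => ∑' m, c m * x ^ e m) =
      fun x => ∑' m, (c m * (e m : ℂ)) * x ^ (e m - 1) := by
  funext x
  have hd := Complex.hasSum_deriv_of_summable_norm (F := fun m (w : ℂ) => c m * w ^ e m)
    (U := Metric.ball 0 (‖x‖ + 1)) (z := x) (h (‖x‖ + 1) (by positivity))
    (fun m => by fun_prop) Metric.isOpen_ball
    (fun m w hw => by
      have hw' : ‖w‖ ≤ ‖x‖ + 1 := by simpa using (mem_ball_zero_iff.mp hw).le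
      rw [norm_mul, norm_pow]
      gcongr)
    (by simp)
  rw [← hd.tsum_eq]
  refine tsum_congr fun m => ?_
  simp [mul_assoc]

/-- The coefficient of `x ^ (n + 2 * m)` in the power series of `sphBesselJ n`. -/
noncomputable def sphBesselJCoeff (n m : ℕ) : ℂ :=
  (-1) ^ m / (2 ^ m * (Nat.factorial m : ℂ) * (Nat.doubleFactorial (2 * (n + m) + 1) : ℂ))

theorem sphBesselJ_eq_tsum_coeff (n : ℕ) :
    sphBesselJ n = fun x => ∑' m, sphBesselJCoeff n m * x ^ (n + 2 * m) := by
  funext x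
  refine tsum_congr fun m => ?_
  rw [sphBesselJCoeff]
  ring

theorem sphBesselJCoeff_succ (n m : ℕ) :
    2 * ((m : ℂ) + 1) * (2 * n + 2 * m + 3) * sphBesselJCoeff n (m + 1) =
      -sphBesselJCoeff n m := by
  have h₁ : (Nat.factorial m : ℂ) ≠ 0 := by exact_mod_cast m.factorial_ne_zero
  have h₂ : (Nat.doubleFactorial (2 * (n + m) + 1) : ℂ) ≠ 0 := by
    exact_mod_cast (Nat.doubleFactorial_pos _).ne'
  have h₃ : (m : ℂ) + 1 ≠ 0 := by exact_mod_cast m.succ_ne_zero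
  have h₄ : (2 * n + 2 * m + 3 : ℂ) ≠ 0 := by
    exact_mod_cast (by omega : 2 * n + 2 * m + 3 ≠ 0)
  have h₅ : (Nat.doubleFactorial (2 * (n + (m + 1)) + 1) : ℂ) =
      (2 * n + 2 * m + 3) * Nat.doubleFactorial (2 * (n + m) + 1) := by
    rw [show 2 * (n + (m + 1)) + 1 = 2 * (n + m) + 1 + 2 by ring, Nat.doubleFactorial_add_two]
    push_cast
    ring
  rw [sphBesselJCoeff, sphBesselJCoeff, h₅, Nat.factorial_succ]
  push_cast
  generalize (2 * n + 2 * m + 3 : ℂ) = a at h₄ ⊢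
  field_simp
  ring

theorem norm_sphBesselJCoeff_le (n m : ℕ) :
    ‖sphBesselJCoeff n m‖ ≤ ((Nat.factorial m : ℝ))⁻¹ := by
  have h₁ : (1 : ℝ) ≤ 2 ^ m := one_le_pow₀ one_le_two
  have h₂ : (1 : ℝ) ≤ (Nat.doubleFactorial (2 * (n + m) + 1) : ℝ) := by
    exact_mod_cast Nat.doubleFactorial_pos _
  have h₃ : (0 : ℝ) < Nat.factorial m := by exact_mod_cast m.factorial_pos
  simp only [sphBesselJCoeff, norm_div, norm_mul, norm_pow, norm_neg, norm_one, one_pow,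
    Complex.norm_natCast, Complex.norm_ofNat, one_div]
  apply inv_anti₀ h₃
  calc (Nat.factorial m : ℝ) = 1 * Nat.factorial m * 1 := by ring
    _ ≤ _ := by gcongr

theorem summable_norm_sphBesselJCoeff_mul_pow (n : ℕ) (R : ℝ) (hR : 0 ≤ R) :
    Summable fun m => ‖sphBesselJCoeff n m‖ * R ^ (n + 2 * m) := by
  refine Summable.of_nonneg_of_le (fun m => by positivity) (fun m => ?_)
    ((Real.summable_pow_div_factorial (R ^ 2)).mul_left (R ^ n))
  calc _ ≤ ((Nat.factorial m : ℝ))⁻¹ * R ^ (n + 2 * m) := by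
        gcongr
        exact norm_sphBesselJCoeff_le n m
    _ = R ^ n * ((R ^ 2) ^ m / Nat.factorial m) := by
        rw [pow_add, pow_mul]
        ring

/-- the spherical Bessel differential equation for `j_n`. -/
theorem sphBesselJ_ode (n : ℕ) (x : ℂ) :
    x ^ 2 * deriv (deriv (sphBesselJ n)) x + 2 * x * deriv (sphBesselJ n) x +
      (x ^ 2 - (n : ℂ) * ((n : ℂ) + 1)) * sphBesselJ n x = 0 := by
  have s₀ := summable_norm_sphBesselJCoeff_mul_pow n
  have s₁ := summable_norm_mul_pow_deriv s₀
  have s₂ := summable_norm_mul_pow_deriv s₁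
  rw [sphBesselJ_eq_tsum_coeff, deriv_tsum_mul_pow s₀, deriv_tsum_mul_pow s₁]
  have H₀ := hasSum_mul_pow_of_summable_norm s₀ x
  have H₁ := hasSum_mul_pow_of_summable_norm s₁ x
  have H₂ := hasSum_mul_pow_of_summable_norm s₂ x
  have euler (k : ℕ) : x ^ 2 * ((k : ℂ) * ((k - 1 : ℕ) : ℂ) * x ^ (k - 1 - 1)) +
      2 * x * ((k : ℂ) * x ^ (k - 1)) = (k : ℂ) * (k + 1) * x ^ k := by
    rcases k with _ | _ | k
    · simp
    · norm_num
    · simp only [Nat.add_sub_cancel]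
      push_cast
      ring
  have A := ((H₂.mul_left (x ^ 2)).add (H₁.mul_left (2 * x))).add
    (H₀.mul_left (-((n : ℂ) * (n + 1))))
  have B := (hasSum_nat_add_iff' 1).mpr A
  have C := B.unique ((H₀.mul_left (-x ^ 2)).congr_fun ?_)
  · simp only [Finset.sum_range_one] at C
    have e₀ := euler n
    simp only [mul_zero, add_zero] at C
    linear_combination C + sphBesselJCoeff n 0 * e₀
  · intro m
    have e₁ := euler (n + 2 * (m + 1))
    have r := sphBesselJCoeff_succ n m
    push_cast at e₁ ⊢
    linear_combination sphBesselJCoeff n (m + 1) * e₁ + x ^ (n + 2 * m + 2) * r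
end

section
/- For every integer n ≥ 0 and every x ∈ ℂ with x ≠ 0, the spherical Neumann function y_n satisfies the spherical Bessel differential equation: x²·y_n''(x) + 2x·y_n'(x) + (x² − n(n+1))·y_n(x) = 0, where y_n' and y_n'' denote the first and second complex derivatives of y_n. -/
open Complex

/-- A Laurent series in `w` whose coefficients decay faster than geometrically can be
differentiated termwise away from the origin. -/
lemma hasSum_deriv_laurent {b : ℕ → ℂ} (hb : ∀ r : ℝ, 0 ≤ r → Summable fun m ↦ ‖b m‖ * r ^ m)
    (k : ℤ) {x : ℂ} (hx : x ≠ 0) :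
    HasSum (fun m : ℕ ↦ b m * ((2 * (m : ℂ) - k) * x ^ (2 * (m : ℤ) - k - 1)))
      (deriv (fun w : ℂ ↦ ∑' m : ℕ, b m * w ^ (2 * (m : ℤ) - k)) x) := by
  have hcont : ContinuousAt (fun w : ℂ ↦ ‖w ^ (-k)‖) x :=
    (continuousAt_zpow₀ x (-k) (Or.inl hx)).norm
  obtain ⟨U, hU, hUo, hxU⟩ := eventually_nhds_iff.mp
    ((eventually_ne_nhds hx).and
      ((hcont.eventually_lt continuousAt_const (lt_add_one ‖x ^ (-k)‖)).and
        (continuousAt_id.norm.eventually_lt continuousAt_const (lt_add_one ‖x‖))))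
  have hdiff (m : ℕ) (w : ℂ) (hw : w ≠ 0) :
      HasDerivAt (fun w : ℂ ↦ b m * w ^ (2 * (m : ℤ) - k))
        (b m * ((2 * (m : ℂ) - k) * w ^ (2 * (m : ℤ) - k - 1))) w := by
    simpa using (hasDerivAt_zpow (2 * (m : ℤ) - k) w (Or.inl hw)).const_mul (b m)
  have key := Complex.hasSum_deriv_of_summable_norm
    (F := fun (m : ℕ) (w : ℂ) ↦ b m * w ^ (2 * (m : ℤ) - k))
    ((hb ((‖x‖ + 1) ^ 2) (by positivity)).mul_right (‖x ^ (-k)‖ + 1))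
    (fun m w hw ↦ (hdiff m w (hU w hw).1).differentiableAt.differentiableWithinAt) hUo
    (fun m w hw ↦ ?_) hxU
  · simpa only [(hdiff _ x hx).deriv] using key
  · obtain ⟨hw0, hwk, hw1⟩ := hU w hw
    have hsplit : w ^ (2 * (m : ℤ) - k) = (w ^ 2) ^ m * w ^ (-k) := by
      rw [sub_eq_add_neg, zpow_add₀ hw0, ← pow_mul]
      norm_cast
    simp only [id] at hw1
    rw [hsplit, norm_mul, norm_mul, norm_pow, norm_pow, ← mul_assoc]
    gcongr

/-- Faster than geometric decay is preserved by termwise differentiation. -/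
lemma summable_norm_mul_linear_mul_pow {b : ℕ → ℂ}
    (hb : ∀ r : ℝ, 0 ≤ r → Summable fun m ↦ ‖b m‖ * r ^ m) (k : ℤ) (r : ℝ) (hr : 0 ≤ r) :
    Summable fun m : ℕ ↦ ‖b m * (2 * (m : ℂ) - k)‖ * r ^ m := by
  refine .of_nonneg_of_le (fun m ↦ by positivity) (fun m ↦ ?_)
    ((hb (2 * r) (by positivity)).mul_left (2 + ‖(k : ℂ)‖))
  have hm : (m : ℝ) ≤ 2 ^ m := by exact_mod_cast Nat.lt_two_pow_self.le
  have h1 : (1 : ℝ) ≤ 2 ^ m := one_le_pow₀ (by norm_num)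
  have hlin : ‖2 * (m : ℂ) - k‖ ≤ (2 + ‖(k : ℂ)‖) * 2 ^ m := by
    calc ‖2 * (m : ℂ) - k‖ ≤ 2 * m + ‖(k : ℂ)‖ := by simpa using norm_sub_le (2 * (m : ℂ)) k
      _ ≤ (2 + ‖(k : ℂ)‖) * 2 ^ m := by nlinarith [norm_nonneg (k : ℂ)]
  calc ‖b m * (2 * (m : ℂ) - k)‖ * r ^ m
      ≤ ‖b m‖ * ((2 + ‖(k : ℂ)‖) * 2 ^ m) * r ^ m := by rw [norm_mul]; gcongr
    _ = (2 + ‖(k : ℂ)‖) * (‖b m‖ * (2 * r) ^ m) := by rw [mul_pow]; ring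

/-- The coefficient of `x ^ (2 * m - n - 1)` in `sphBesselY n x`. -/
noncomputable def sphBesselYCoeff (n m : ℕ) : ℂ :=
  -((Nat.factorial (2 * n) : ℂ) / ((2 : ℂ) ^ n * (Nat.factorial n : ℂ))) *
    ((-1 : ℂ) ^ m / ((2 : ℂ) ^ m * (Nat.factorial m : ℂ) *
      ∏ j ∈ Finset.range m, ((2 * (j : ℂ) + 1) - 2 * (n : ℂ))))

lemma sphBesselY_eq_tsum (n : ℕ) :
    sphBesselY n =
      fun x ↦ ∑' m : ℕ, sphBesselYCoeff n m * x ^ (2 * (m : ℤ) - ((n : ℤ) + 1)) := by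
  funext x
  rw [sphBesselY, ← tsum_mul_left]
  refine tsum_congr fun m ↦ ?_
  rw [sphBesselYCoeff, sub_sub]
  ring

lemma one_le_norm_two_mul_add_one_sub (j n : ℕ) : 1 ≤ ‖(2 * (j : ℂ) + 1) - 2 * (n : ℂ)‖ := by
  have hcast : (2 * (j : ℂ) + 1) - 2 * (n : ℂ) = ((2 * j + 1 - 2 * n : ℤ) : ℂ) := by push_cast; ring
  rw [hcast, Complex.norm_intCast]
  exact_mod_cast Int.one_le_abs (by lia : (2 * j + 1 - 2 * n : ℤ) ≠ 0)

lemma sphBesselYCoeff_succ (n m : ℕ) :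
    sphBesselYCoeff n (m + 1) * (2 * ((m : ℂ) + 1) * (2 * (m : ℂ) + 1 - 2 * n)) =
      -sphBesselYCoeff n m := by
  have hne (j : ℕ) : (2 * (j : ℂ) + 1) - 2 * (n : ℂ) ≠ 0 :=
    norm_pos_iff.mp (zero_lt_one.trans_le (one_le_norm_two_mul_add_one_sub j n))
  have hprod : ∏ j ∈ Finset.range m, ((2 * (j : ℂ) + 1) - 2 * (n : ℂ)) ≠ 0 :=
    Finset.prod_ne_zero_iff.mpr fun j _ ↦ hne j
  have hm : (m : ℂ) + 1 ≠ 0 := Nat.cast_add_one_ne_zero m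
  have hfac (i : ℕ) : (Nat.factorial i : ℂ) ≠ 0 := mod_cast i.factorial_ne_zero
  have hm2 : 2 * (m : ℂ) + 1 - 2 * n ≠ 0 := hne m
  have := hfac m
  have := hfac n
  rw [sphBesselYCoeff, sphBesselYCoeff, Finset.prod_range_succ, Nat.factorial_succ]
  push_cast
  generalize 2 * (m : ℂ) + 1 - 2 * n = d at hm2 ⊢
  field_simp
  ring

lemma summable_norm_sphBesselYCoeff_mul_pow (n : ℕ) (r : ℝ) (hr : 0 ≤ r) :
    Summable fun m ↦ ‖sphBesselYCoeff n m‖ * r ^ m := by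
  set C : ℂ := -((Nat.factorial (2 * n) : ℂ) / ((2 : ℂ) ^ n * (Nat.factorial n : ℂ))) with hC
  refine .of_nonneg_of_le (fun m ↦ by positivity) (fun m ↦ ?_)
    ((Real.summable_pow_div_factorial r).mul_left ‖C‖)
  have hprod : 1 ≤ ∏ j ∈ Finset.range m, ‖(2 * (j : ℂ) + 1) - 2 * (n : ℂ)‖ :=
    Finset.one_le_prod fun j _ ↦ one_le_norm_two_mul_add_one_sub j n
  have hpow : (1 : ℝ) ≤ 2 ^ m := one_le_pow₀ (by norm_num)
  have hden : (Nat.factorial m : ℝ) ≤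
      2 ^ m * Nat.factorial m * ∏ j ∈ Finset.range m, ‖(2 * (j : ℂ) + 1) - 2 * (n : ℂ)‖ :=
    calc (Nat.factorial m : ℝ) = 1 * Nat.factorial m * 1 := by ring
      _ ≤ _ := by gcongr
  have hcoeff : ‖sphBesselYCoeff n m‖ ≤ ‖C‖ * (1 / Nat.factorial m) := by
    rw [sphBesselYCoeff, ← hC, norm_mul, norm_div, norm_mul, norm_mul, norm_prod]
    simp only [norm_pow, norm_neg, norm_one, one_pow, Complex.norm_natCast, Complex.norm_ofNat]
    gcongr
  calc ‖sphBesselYCoeff n m‖ * r ^ m ≤ ‖C‖ * (1 / Nat.factorial m) * r ^ m := by gcongr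
    _ = ‖C‖ * (r ^ m / Nat.factorial m) := by ring

lemma summable_laurent {b : ℕ → ℂ} (hb : ∀ r : ℝ, 0 ≤ r → Summable fun m ↦ ‖b m‖ * r ^ m)
    (k : ℤ) {x : ℂ} (hx : x ≠ 0) : Summable fun m : ℕ ↦ b m * x ^ (2 * (m : ℤ) - k) := by
  refine .of_norm (((hb (‖x‖ ^ 2) (by positivity)).mul_right ‖x ^ (-k)‖).congr fun m ↦ ?_)
  rw [sub_eq_add_neg, zpow_add₀ hx, ← norm_pow, ← norm_pow, ← norm_mul, ← norm_mul, ← pow_mul,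
    mul_assoc]
  norm_cast

/-- the spherical Bessel differential equation for `y_n`. -/
theorem sphBesselY_ode (n : ℕ) (x : ℂ) (hx : x ≠ 0) :
    x ^ 2 * deriv (deriv (sphBesselY n)) x + 2 * x * deriv (sphBesselY n) x +
      (x ^ 2 - (n : ℂ) * ((n : ℂ) + 1)) * sphBesselY n x = 0 := by
  have ha := summable_norm_sphBesselYCoeff_mul_pow n
  set a := sphBesselYCoeff n
  set k : ℤ := (n : ℤ) + 1 with hk
  have hkc : (k : ℂ) = n + 1 := by simp [hk]
  have h0 : HasSum (fun m : ℕ ↦ a m * x ^ (2 * (m : ℤ) - k)) (sphBesselY n x) := by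
    rw [sphBesselY_eq_tsum]
    exact (summable_laurent ha k hx).hasSum
  have h1 {w : ℂ} (hw : w ≠ 0) :
      HasSum (fun m : ℕ ↦ a m * (2 * (m : ℂ) - k) * w ^ (2 * (m : ℤ) - (k + 1)))
        (deriv (sphBesselY n) w) := by
    rw [sphBesselY_eq_tsum]
    simpa only [← mul_assoc, sub_sub] using hasSum_deriv_laurent ha k hw
  have h2 := hasSum_deriv_laurent (summable_norm_mul_linear_mul_pow ha k) (k + 1) hx
  have hderiv : deriv (sphBesselY n) =ᶠ[nhds x]
      fun w ↦ ∑' m : ℕ, a m * (2 * (m : ℂ) - k) * w ^ (2 * (m : ℤ) - (k + 1)) := by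
    filter_upwards [eventually_ne_nhds hx] with w hw using (h1 hw).tsum_eq.symm
  rw [← hderiv.deriv_eq] at h2
  have hzpow (m : ℕ) : x ^ (2 * (m : ℤ) - k) = x ^ 2 * x ^ (2 * (m : ℤ) - (k + 1) - 1) ∧
      x ^ (2 * (m : ℤ) - k) = x * x ^ (2 * (m : ℤ) - (k + 1)) := by
    constructor
    · rw [← zpow_natCast, ← zpow_add₀ hx]; congr 1; push_cast; ring
    · rw [← zpow_one_add₀ hx]; congr 1; ring
  have hE : HasSum (fun m : ℕ ↦ a m * (2 * m * (2 * m - 1 - 2 * n)) * x ^ (2 * (m : ℤ) - k))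
      (x ^ 2 * deriv (deriv (sphBesselY n)) x + 2 * x * deriv (sphBesselY n) x -
        n * (n + 1) * sphBesselY n x) := by
    have h := ((h2.mul_left (x ^ 2)).add ((h1 hx).mul_left (2 * x))).sub
      (h0.mul_left ((n : ℂ) * (n + 1)))
    refine h.congr_fun fun m ↦ ?_
    obtain ⟨hz2, hz1⟩ := hzpow m
    push_cast
    rw [hkc]
    linear_combination
      a m * (2 * m - (n + 1)) * (2 * m - (n + 1) - 1) * hz2 + 2 * a m * (2 * m - (n + 1)) * hz1
  have hshift : HasSum (fun m : ℕ ↦ -(x ^ 2 * (a m * x ^ (2 * (m : ℤ) - k))))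
      (x ^ 2 * deriv (deriv (sphBesselY n)) x + 2 * x * deriv (sphBesselY n) x -
        n * (n + 1) * sphBesselY n x) := by
    have h := (hasSum_nat_add_iff' 1).mpr hE
    simp only [Finset.sum_range_one, Nat.cast_zero, mul_zero, zero_mul, sub_zero] at h
    refine h.congr_fun fun m ↦ ?_
    have hx2 : x ^ (2 * ((m + 1 : ℕ) : ℤ) - k) = x ^ 2 * x ^ (2 * (m : ℤ) - k) := by
      rw [← zpow_natCast, ← zpow_add₀ hx]; congr 1; push_cast; ring
    rw [hx2]
    push_cast
    linear_combination -(x ^ 2 * x ^ (2 * (m : ℤ) - k)) * sphBesselYCoeff_succ n m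
  linear_combination hshift.unique (h0.mul_left (x ^ 2)).neg
end

section
/- (Large-order asymptotics of h_n^{(1)}.) For every x ∈ ℂ with x ≠ 0 there exists a constant C > 0 such that for every integer n ≥ 1, |i·x^{n+1}·h_n^{(1)}(x) − (2n−1)!!| ≤ (C/n)·(2n−1)!!. -/
open Complex

/-- The exponential series with parameter `r ^ 2 / 2`. -/
theorem hasSum_exp_sq_div_two (r : ℝ) :
    HasSum (fun m : ℕ => (r ^ 2 / 2) ^ m / (m.factorial : ℝ)) (Real.exp (r ^ 2 / 2)) := by
  rw [Real.exp_eq_exp_ℝ]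
  exact NormedSpace.expSeries_div_hasSum_exp (r ^ 2 / 2)

theorem doubleFactorial_odd_monotone : Monotone fun k : ℕ => Nat.doubleFactorial (2 * k + 1) := by
  refine monotone_nat_of_le_succ fun k => ?_
  rw [show 2 * (k + 1) + 1 = (2 * k + 1) + 2 by ring, Nat.doubleFactorial_add_two]
  exact Nat.le_mul_of_pos_left _ (by omega)

theorem factorial_le_doubleFactorial_odd (n : ℕ) :
    (n + 1).factorial ≤ Nat.doubleFactorial (2 * n + 1) := by
  induction n with
  | zero => simp
  | succ k ih =>
    rw [show 2 * (k + 1) + 1 = (2 * k + 1) + 2 by ring, Nat.doubleFactorial_add_two,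
      Nat.factorial_succ]
    exact Nat.mul_le_mul (by omega) ih

theorem factorial_two_mul_div (n : ℕ) :
    (Nat.factorial (2 * n) : ℂ) / ((2 : ℂ) ^ n * (Nat.factorial n : ℂ)) =
      (Nat.doubleFactorial (2 * n - 1) : ℂ) := by
  have h : Nat.factorial (2 * n) = 2 ^ n * n.factorial * Nat.doubleFactorial (2 * n - 1) := by
    cases n with
    | zero => simp
    | succ k =>
      rw [show 2 * (k + 1) = (2 * k + 1) + 1 by ring, Nat.factorial_eq_mul_doubleFactorial,
        show (2 * k + 1) + 1 = 2 * (k + 1) by ring, Nat.doubleFactorial_two_mul]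
      rfl
  have h0 : (Nat.factorial n : ℂ) ≠ 0 := by exact_mod_cast n.factorial_ne_zero
  rw [div_eq_iff (mul_ne_zero (pow_ne_zero _ two_ne_zero) h0), h]
  push_cast
  ring

theorem one_le_norm_odd_sub (n j : ℕ) : 1 ≤ ‖(2 * (j : ℂ) + 1) - 2 * (n : ℂ)‖ := by
  have h : (2 * (j : ℂ) + 1) - 2 * (n : ℂ) = ((2 * j + 1 - 2 * n : ℤ) : ℂ) := by push_cast; ring
  rw [h, Complex.norm_intCast]
  have h1 : (1 : ℤ) ≤ |2 * (j : ℤ) + 1 - 2 * n| := Int.one_le_abs (by omega)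
  exact_mod_cast h1

theorem le_norm_prod_odd_sub (n m : ℕ) (hn : 1 ≤ n) :
    (n : ℝ) ≤ ‖∏ j ∈ Finset.range (m + 1), ((2 * (j : ℂ) + 1) - 2 * (n : ℂ))‖ := by
  rw [norm_prod, Finset.prod_range_succ']
  have h1 : 1 ≤ ∏ j ∈ Finset.range m, ‖(2 * ((j + 1 : ℕ) : ℂ) + 1) - 2 * (n : ℂ)‖ :=
    Finset.one_le_prod fun j _ => one_le_norm_odd_sub n (j + 1)
  have h0 : (n : ℝ) ≤ ‖(2 * ((0 : ℕ) : ℂ) + 1) - 2 * (n : ℂ)‖ := by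
    have h : (2 * ((0 : ℕ) : ℂ) + 1) - 2 * (n : ℂ) = ((1 - 2 * n : ℤ) : ℂ) := by push_cast; ring
    rw [h, Complex.norm_intCast]
    have : (n : ℤ) ≤ |1 - 2 * (n : ℤ)| := le_abs.2 (Or.inr (by omega))
    exact_mod_cast this
  nlinarith [norm_nonneg ((2 * ((0 : ℕ) : ℂ) + 1) - 2 * (n : ℂ))]

theorem norm_sphBesselJ_le (n : ℕ) (x : ℂ) :
    ‖sphBesselJ n x‖ ≤
      ‖x‖ ^ n / (Nat.doubleFactorial (2 * n + 1) : ℝ) * Real.exp (‖x‖ ^ 2 / 2) := by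
  refine tsum_of_norm_bounded ((hasSum_exp_sq_div_two ‖x‖).mul_left _) fun m => ?_
  have hd : (Nat.doubleFactorial (2 * n + 1) : ℝ) ≤ Nat.doubleFactorial (2 * (n + m) + 1) := by
    exact_mod_cast doubleFactorial_odd_monotone (Nat.le_add_right n m)
  have hp : (0 : ℝ) < Nat.doubleFactorial (2 * n + 1) := by
    exact_mod_cast Nat.doubleFactorial_pos _
  have hm : (0 : ℝ) < m.factorial := by exact_mod_cast m.factorial_pos
  simp only [norm_div, norm_mul, norm_pow, norm_neg, norm_one, one_pow, one_mul,
    Complex.norm_natCast, Complex.norm_ofNat]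
  calc ‖x‖ ^ (n + 2 * m) / (2 ^ m * m.factorial * Nat.doubleFactorial (2 * (n + m) + 1))
      ≤ ‖x‖ ^ (n + 2 * m) / (2 ^ m * m.factorial * Nat.doubleFactorial (2 * n + 1)) := by
        gcongr
    _ = _ := by
        rw [pow_add, pow_mul, div_pow]
        field_simp

/-- `x ^ (n + 1) * y_n(x)` equals `-(2n - 1)!!` up to a relative error `O(1 / n)`. -/
theorem norm_pow_mul_sphBesselY_add_le (n : ℕ) (hn : 1 ≤ n) (x : ℂ) (hx : x ≠ 0) :
    ‖x ^ (n + 1) * sphBesselY n x + (Nat.doubleFactorial (2 * n - 1) : ℂ)‖ ≤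
      Nat.doubleFactorial (2 * n - 1) * (Real.exp (‖x‖ ^ 2 / 2) / n) := by
  have hn0 : (0 : ℝ) < n := by exact_mod_cast hn
  set a : ℕ → ℂ := fun m => ((-1 : ℂ) ^ m * x ^ (2 * m)) / ((2 : ℂ) ^ m * (Nat.factorial m : ℂ) *
    ∏ j ∈ Finset.range m, ((2 * (j : ℂ) + 1) - 2 * (n : ℂ))) with ha
  set f : ℕ → ℂ := fun m => a m - if m = 0 then 1 else 0 with hf
  have hbound (m : ℕ) : ‖f m‖ ≤ (‖x‖ ^ 2 / 2) ^ m / (m.factorial : ℝ) / n := by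
    cases m with
    | zero => simp [hf, ha]
    | succ k =>
      have hP := le_norm_prod_odd_sub n k hn
      have hm : (0 : ℝ) < (k + 1).factorial := by exact_mod_cast (k + 1).factorial_pos
      simp only [hf, ha, Nat.add_eq_zero_iff, one_ne_zero, and_false, if_false, sub_zero, norm_div,
        norm_mul, norm_pow, norm_neg, norm_one, one_pow, one_mul, Complex.norm_natCast,
        Complex.norm_ofNat]
      calc _ ≤ ‖x‖ ^ (2 * (k + 1)) / (2 ^ (k + 1) * (k + 1).factorial * n) := by gcongr
        _ = _ := by
          rw [pow_mul, div_pow]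
          field_simp
  have hg := (hasSum_exp_sq_div_two ‖x‖).div_const (n : ℝ)
  have hfs : Summable f := Summable.of_norm_bounded hg.summable hbound
  have has : HasSum a (∑' m, f m + 1) := by
    have := hfs.hasSum.add (hasSum_ite_eq (0 : ℕ) (1 : ℂ))
    simpa [hf] using this
  have hY : x ^ (n + 1) * sphBesselY n x =
      -(Nat.doubleFactorial (2 * n - 1) : ℂ) * (∑' m, f m + 1) := by
    rw [sphBesselY, factorial_two_mul_div, mul_left_comm, ← tsum_mul_left, ← has.tsum_eq]
    congr 2
    ext m
    have h : x ^ (2 * m) = x ^ (n + 1) * x ^ (2 * (m : ℤ) - (n : ℤ) - 1) := by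
      rw [← zpow_natCast, ← zpow_natCast, ← zpow_add₀ hx]
      congr 1
      push_cast
      ring
    simp only [ha, h]
    ring
  rw [hY, show -(Nat.doubleFactorial (2 * n - 1) : ℂ) * (∑' m, f m + 1) +
    (Nat.doubleFactorial (2 * n - 1) : ℂ) =
      -((Nat.doubleFactorial (2 * n - 1) : ℂ) * ∑' m, f m) by ring, norm_neg, norm_mul,
    Complex.norm_natCast]
  gcongr
  exact tsum_of_norm_bounded hg hbound

theorem norm_pow_mul_sphBesselJ_le (n : ℕ) (hn : 1 ≤ n) (x : ℂ) :
    ‖x ^ (n + 1) * sphBesselJ n x‖ ≤ Nat.doubleFactorial (2 * n - 1) *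
      (‖x‖ * Real.exp (‖x‖ ^ 2) * Real.exp (‖x‖ ^ 2 / 2) / n) := by
  obtain ⟨k, rfl⟩ := Nat.exists_eq_add_of_le' hn
  rw [show 2 * (k + 1) - 1 = 2 * k + 1 by omega]
  set D : ℝ := (Nat.doubleFactorial (2 * k + 1) : ℝ) with hD
  have hD1 : 1 ≤ D := by
    rw [hD]
    exact_mod_cast Nat.doubleFactorial_pos _
  have hfac : ((k + 1).factorial : ℝ) ≤ D := by
    rw [hD]
    exact_mod_cast factorial_le_doubleFactorial_odd k
  have hpow : (‖x‖ ^ 2) ^ (k + 1) ≤ Real.exp (‖x‖ ^ 2) * D := by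
    have h := Real.pow_div_factorial_le_exp (‖x‖ ^ 2) (sq_nonneg _) (k + 1)
    rw [div_le_iff₀ (by positivity)] at h
    exact h.trans (by gcongr)
  have hsucc : (Nat.doubleFactorial (2 * (k + 1) + 1) : ℝ) = (2 * k + 3) * D := by
    rw [show 2 * (k + 1) + 1 = (2 * k + 1) + 2 by ring, Nat.doubleFactorial_add_two, hD]
    push_cast
    ring
  have hJ := norm_sphBesselJ_le (k + 1) x
  rw [hsucc] at hJ
  rw [norm_mul, norm_pow]
  push_cast
  calc ‖x‖ ^ (k + 1 + 1) * ‖sphBesselJ (k + 1) x‖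
      ≤ ‖x‖ ^ (k + 1 + 1) *
          (‖x‖ ^ (k + 1) / ((2 * k + 3) * D) * Real.exp (‖x‖ ^ 2 / 2)) := by gcongr
    _ = ‖x‖ * (‖x‖ ^ 2) ^ (k + 1) * Real.exp (‖x‖ ^ 2 / 2) / ((2 * k + 3) * D) := by ring
    _ ≤ ‖x‖ * (Real.exp (‖x‖ ^ 2) * D) * Real.exp (‖x‖ ^ 2 / 2) / ((k + 1) * 1) := by
        gcongr <;> linarith
    _ = _ := by ring

/-- large-order asymptotics of the spherical Hankel function. -/
theorem sphHankelH1_large_order (x : ℂ) (hx : x ≠ 0) :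
    ∃ C > (0 : ℝ), ∀ n : ℕ, 1 ≤ n →
      ‖Complex.I * x ^ (n + 1) * sphHankelH1 n x - (Nat.doubleFactorial (2 * n - 1) : ℂ)‖
        ≤ (C / n) * (Nat.doubleFactorial (2 * n - 1) : ℝ) := by
  refine ⟨‖x‖ * Real.exp (‖x‖ ^ 2) * Real.exp (‖x‖ ^ 2 / 2) + Real.exp (‖x‖ ^ 2 / 2),
    by positivity, fun n hn => ?_⟩
  have h : Complex.I * x ^ (n + 1) * sphHankelH1 n x - (Nat.doubleFactorial (2 * n - 1) : ℂ) =
      Complex.I * (x ^ (n + 1) * sphBesselJ n x) -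
        (x ^ (n + 1) * sphBesselY n x + (Nat.doubleFactorial (2 * n - 1) : ℂ)) := by
    rw [sphHankelH1]
    linear_combination x ^ (n + 1) * sphBesselY n x * Complex.I_mul_I
  rw [h]
  refine (norm_sub_le _ _).trans ?_
  rw [norm_mul, Complex.norm_I, one_mul]
  refine (add_le_add (norm_pow_mul_sphBesselJ_le n hn x)
    (norm_pow_mul_sphBesselY_add_le n hn x hx)).trans_eq ?_
  ring
end

section
/- (Large-argument asymptotic expansion of j_n.) For every integer n ≥ 0 there exists a constant C > 0 such that for every x ∈ ℂ with |x| ≥ 1, |2x·j_n(x) − e^{i(x − (n+1)π/2)} − e^{−i(x − (n+1)π/2)}| ≤ C·e^{|Im(x)|}/|x|. -/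
open Complex

theorem doubleFactorial_two_mul_add_three (k : ℕ) :
    (Nat.doubleFactorial (2 * (k + 1) + 1) : ℂ) =
      (2 * k + 3) * (Nat.doubleFactorial (2 * k + 1) : ℂ) := by
  rw [show 2 * (k + 1) + 1 = (2 * k + 1) + 2 by ring, Nat.doubleFactorial_add_two]
  push_cast
  ring

theorem factorial_two_mul_add_one_eq (m : ℕ) :
    (Nat.factorial (2 * m + 1) : ℂ) =
      2 ^ m * (Nat.factorial m : ℂ) * (Nat.doubleFactorial (2 * m + 1) : ℂ) := by
  rw [Nat.factorial_eq_mul_doubleFactorial, Nat.doubleFactorial_two_mul]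
  push_cast
  ring

theorem natCast_doubleFactorial_ne_zero (k : ℕ) : (Nat.doubleFactorial k : ℂ) ≠ 0 :=
  Nat.cast_ne_zero.mpr (Nat.doubleFactorial_pos k).ne'

theorem natCast_two_mul_add_three_ne_zero (k : ℕ) : (2 * k + 3 : ℂ) ≠ 0 := by
  exact_mod_cast (by positivity : 2 * k + 3 ≠ 0)

theorem summable_sphBesselJ (n : ℕ) (x : ℂ) :
    Summable fun m : ℕ => ((-1 : ℂ) ^ m * x ^ (n + 2 * m)) /
      ((2 : ℂ) ^ m * (Nat.factorial m : ℂ) * (Nat.doubleFactorial (2 * (n + m) + 1) : ℂ)) := by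
  refine Summable.of_norm_bounded
    ((Real.summable_pow_div_factorial (‖x‖ ^ 2)).mul_left (‖x‖ ^ n)) fun m => ?_
  have hD : (1 : ℝ) ≤ Nat.doubleFactorial (2 * (n + m) + 1) := by
    exact_mod_cast Nat.doubleFactorial_pos _
  have h2 : (1 : ℝ) ≤ 2 ^ m := one_le_pow₀ (by norm_num)
  have hm : (0 : ℝ) < Nat.factorial m := by exact_mod_cast Nat.factorial_pos m
  simp only [norm_div, norm_mul, norm_pow, norm_neg, norm_one, one_pow, one_mul,
    Complex.norm_natCast, Complex.norm_ofNat]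
  rw [pow_add, pow_mul, ← mul_div_assoc]
  gcongr
  calc (Nat.factorial m : ℝ) = 1 * Nat.factorial m * 1 := by ring
    _ ≤ _ := by gcongr

theorem mul_sphBesselJ_zero (x : ℂ) : x * sphBesselJ 0 x = sin x := by
  rw [sphBesselJ, ← tsum_mul_left, ← (Complex.hasSum_sin x).tsum_eq]
  refine tsum_congr fun m => ?_
  rw [factorial_two_mul_add_one_eq]
  simp only [zero_add]
  ring

theorem mul_sphBesselJ_one (x : ℂ) : x * sphBesselJ 1 x = sphBesselJ 0 x - cos x := by
  have hc := Complex.hasSum_cos x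
  have hs := (summable_sphBesselJ 0 x).sub hc.summable
  rw [← hc.tsum_eq]
  unfold sphBesselJ
  rw [← (summable_sphBesselJ 0 x).tsum_sub hc.summable, hs.tsum_eq_zero_add, ← tsum_mul_left]
  simp only [mul_zero, zero_add, pow_zero, Nat.factorial_zero, Nat.cast_one, mul_one,
    Nat.doubleFactorial, div_one, sub_self]
  refine tsum_congr fun m => ?_
  have h3 := natCast_two_mul_add_three_ne_zero m
  have hfac : (Nat.factorial (2 * (m + 1)) : ℂ) =
      2 ^ (m + 1) * (Nat.factorial (m + 1) : ℂ) * (Nat.doubleFactorial (2 * m + 1) : ℂ) := by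
    have h := factorial_two_mul_add_one_eq (m + 1)
    rw [Nat.factorial_succ, doubleFactorial_two_mul_add_three] at h
    push_cast at h
    apply mul_left_cancel₀ h3
    linear_combination h
  rw [hfac, show 1 + m = m + 1 by ring, doubleFactorial_two_mul_add_three, Nat.factorial_succ]
  have hD := natCast_doubleFactorial_ne_zero (2 * m + 1)
  have hm : (Nat.factorial m : ℂ) ≠ 0 := Nat.cast_ne_zero.mpr (Nat.factorial_ne_zero m)
  have hm1 : (m + 1 : ℂ) ≠ 0 := Nat.cast_add_one_ne_zero m
  push_cast
  field_simp
  ring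

theorem mul_sphBesselJ_add_two (n : ℕ) (x : ℂ) :
    x * sphBesselJ (n + 2) x = (2 * n + 3) * sphBesselJ (n + 1) x - x * sphBesselJ n x := by
  have h1 := (summable_sphBesselJ (n + 1) x).mul_left (2 * n + 3 : ℂ)
  have h0 := (summable_sphBesselJ n x).mul_left x
  unfold sphBesselJ
  rw [← tsum_mul_left, ← tsum_mul_left, ← tsum_mul_left, ← h1.tsum_sub h0,
    (h1.sub h0).tsum_eq_zero_add]
  have hD (k : ℕ) := natCast_doubleFactorial_ne_zero (2 * k + 1)
  have hzero : (2 * n + 3 : ℂ) * (((-1 : ℂ) ^ 0 * x ^ (n + 1 + 2 * 0)) / ((2 : ℂ) ^ 0 *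
      (Nat.factorial 0 : ℂ) * (Nat.doubleFactorial (2 * (n + 1 + 0) + 1) : ℂ))) -
      x * (((-1 : ℂ) ^ 0 * x ^ (n + 2 * 0)) / ((2 : ℂ) ^ 0 *
      (Nat.factorial 0 : ℂ) * (Nat.doubleFactorial (2 * (n + 0) + 1) : ℂ))) = 0 := by
    have h3 := natCast_two_mul_add_three_ne_zero n
    have := hD n
    simp only [add_zero, mul_zero, doubleFactorial_two_mul_add_three, Nat.factorial_zero]
    push_cast
    field_simp
    ring
  rw [hzero, zero_add]
  refine tsum_congr fun m => ?_
  have h3 := natCast_two_mul_add_three_ne_zero (n + m + 1)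
  have hDm := hD (n + m + 1)
  have hm : (Nat.factorial m : ℂ) ≠ 0 := Nat.cast_ne_zero.mpr (Nat.factorial_ne_zero m)
  have hm1 : (m + 1 : ℂ) ≠ 0 := Nat.cast_add_one_ne_zero m
  rw [show n + 2 + m = n + m + 1 + 1 by ring, show n + 1 + (m + 1) = n + m + 1 + 1 by ring,
    show n + (m + 1) = n + m + 1 by ring, doubleFactorial_two_mul_add_three (n + m + 1),
    Nat.factorial_succ]
  push_cast at h3 ⊢
  field_simp
  ring

theorem norm_exp_le_exp_abs_re (z : ℂ) : ‖exp z‖ ≤ Real.exp |z.re| := by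
  rw [Complex.norm_exp]
  exact Real.exp_le_exp.mpr (le_abs_self _)

theorem norm_cos_le_exp_abs_im (z : ℂ) : ‖cos z‖ ≤ Real.exp |z.im| := by
  have h1 := norm_exp_le_exp_abs_re (z * I)
  have h2 := norm_exp_le_exp_abs_re (-z * I)
  simp only [mul_I_re, neg_im, neg_neg, abs_neg] at h1 h2
  have h : ‖2 * cos z‖ ≤ Real.exp |z.im| + Real.exp |z.im| := by
    rw [two_cos]
    exact (norm_add_le _ _).trans (add_le_add h1 h2)
  rw [norm_mul, Complex.norm_ofNat] at h
  linarith

theorem exists_norm_two_mul_sphBesselJ_sub_cos_le (n : ℕ) :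
    ∃ C > (0 : ℝ), ∀ x : ℂ, 1 ≤ ‖x‖ →
      ‖2 * x * sphBesselJ n x - 2 * cos (x - ((n : ℂ) + 1) * Real.pi / 2)‖
        ≤ C * Real.exp |x.im| / ‖x‖ := by
  have hcos (k : ℕ) (x : ℂ) :
      ‖cos (x - ((k : ℂ) + 1) * Real.pi / 2)‖ ≤ Real.exp |x.im| := by
    convert norm_cos_le_exp_abs_im (x - ((k : ℂ) + 1) * Real.pi / 2) using 3
    rw [show ((k : ℂ) + 1) * Real.pi / 2 = (((k + 1) * Real.pi / 2 : ℝ) : ℂ) by push_cast; rfl]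
    simp
  induction n using Nat.twoStepInduction with
  | zero =>
    refine ⟨1, one_pos, fun x _ => ?_⟩
    rw [mul_assoc, mul_sphBesselJ_zero]
    simp only [Nat.cast_zero, zero_add, one_mul, cos_sub_pi_div_two, sub_self, norm_zero]
    positivity
  | one =>
    refine ⟨2, two_pos, fun x hx => ?_⟩
    have hx0 : 0 < ‖x‖ := one_pos.trans_le hx
    have hπ : x - ((1 : ℕ) + 1 : ℂ) * Real.pi / 2 = x - Real.pi := by push_cast; ring
    rw [hπ, cos_sub_pi, mul_assoc, mul_sphBesselJ_one, le_div_iff₀ hx0, ← norm_mul,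
      show (2 * (sphBesselJ 0 x - cos x) - 2 * -cos x) * x = 2 * (x * sphBesselJ 0 x) by ring,
      mul_sphBesselJ_zero, norm_mul, Complex.norm_ofNat]
    have h := hcos 0 x
    simp only [Nat.cast_zero, zero_add, one_mul, cos_sub_pi_div_two] at h
    gcongr
  | more n ih0 ih1 =>
    obtain ⟨C₀, hC₀, h0⟩ := ih0
    obtain ⟨C₁, hC₁, h1⟩ := ih1
    refine ⟨(2 * n + 3) * (C₁ + 2) + C₀, by positivity, fun x hx => ?_⟩
    have hx0 : 0 < ‖x‖ := one_pos.trans_le hx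
    have hπ : x - (((n + 2 : ℕ) : ℂ) + 1) * Real.pi / 2 =
        x - ((n : ℂ) + 1) * Real.pi / 2 - Real.pi := by push_cast; ring
    have hJ : ‖2 * sphBesselJ (n + 1) x‖ ≤ (C₁ + 2) * Real.exp |x.im| / ‖x‖ := by
      rw [le_div_iff₀ hx0, ← norm_mul]
      calc ‖2 * sphBesselJ (n + 1) x * x‖
          = ‖(2 * x * sphBesselJ (n + 1) x
              - 2 * cos (x - (((n + 1 : ℕ) : ℂ) + 1) * Real.pi / 2))
              + 2 * cos (x - (((n + 1 : ℕ) : ℂ) + 1) * Real.pi / 2)‖ := by ring_nf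
        _ ≤ C₁ * Real.exp |x.im| / ‖x‖ + 2 * Real.exp |x.im| := by
            refine (norm_add_le _ _).trans (add_le_add (h1 x hx) ?_)
            rw [norm_mul, Complex.norm_ofNat]
            gcongr
            exact hcos (n + 1) x
        _ ≤ C₁ * Real.exp |x.im| + 2 * Real.exp |x.im| := by
            gcongr
            exact div_le_self (by positivity) hx
        _ = (C₁ + 2) * Real.exp |x.im| := by ring
    have hn : ‖(2 * n + 3 : ℂ)‖ = 2 * n + 3 := by
      exact_mod_cast Complex.norm_natCast (2 * n + 3)
    rw [hπ, cos_sub_pi, mul_assoc, mul_sphBesselJ_add_two]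
    calc ‖2 * ((2 * n + 3) * sphBesselJ (n + 1) x - x * sphBesselJ n x)
            - 2 * -cos (x - ((n : ℂ) + 1) * Real.pi / 2)‖
        = ‖(2 * n + 3) * (2 * sphBesselJ (n + 1) x) - (2 * x * sphBesselJ n x
            - 2 * cos (x - ((n : ℂ) + 1) * Real.pi / 2))‖ := by ring_nf
      _ ≤ (2 * n + 3) * ((C₁ + 2) * Real.exp |x.im| / ‖x‖) + C₀ * Real.exp |x.im| / ‖x‖ := by
          refine (norm_sub_le _ _).trans (add_le_add ?_ (h0 x hx))
          rw [norm_mul, hn]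
          gcongr
      _ = ((2 * n + 3) * (C₁ + 2) + C₀) * Real.exp |x.im| / ‖x‖ := by ring

/-- large-argument asymptotic expansion of `j_n`. -/
theorem sphBesselJ_large_argument (n : ℕ) :
    ∃ C > (0 : ℝ), ∀ x : ℂ, 1 ≤ ‖x‖ →
      ‖2 * x * sphBesselJ n x
          - Complex.exp (Complex.I * (x - ((n : ℂ) + 1) * Real.pi / 2))
          - Complex.exp (-Complex.I * (x - ((n : ℂ) + 1) * Real.pi / 2))‖
        ≤ C * Real.exp |x.im| / ‖x‖ := by
  obtain ⟨C, hC, h⟩ := exists_norm_two_mul_sphBesselJ_sub_cos_le n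
  refine ⟨C, hC, fun x hx => ?_⟩
  convert h x hx using 2
  rw [two_cos, sub_sub]
  ring_nf
end
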